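/- Let L be a nonempty convex subset of ℝ^{b₁×⋯×b_p} and Λ* ∈ L. Let b : ℝ → ℝ be differentiable, let α > 0, let Z¹,…,Zⁿ ∈ ℝ^{b₁×⋯×b_p} be tensor predictors and y¹,…,yⁿ ∈ ℝ responses. Define μⁱ := b'(⟨Λ*, Zⁱ⟩) and the Kullback–Leibler loss d(Λ) := (1/α)·Σ_{i=1}^n ( μⁱ·⟨Λ* − Λ, Zⁱ⟩ − b(⟨Λ*, Zⁱ⟩) + b(⟨Λ, Zⁱ⟩) ). Let u be a regularizer on ℝ^{b₁×⋯×b_p} with dual ũ and with u(Λ*) < ∞ and u(−Λ*) < ∞, let r > 0, and let Λ̂ ∈ L minimize Λ ↦ (1/α)·Σ_{i=1}^n ( −yⁱ·⟨Λ, Zⁱ⟩ + b(⟨Λ, Zⁱ⟩) ) + r·u(Λ) over L. Then, whenever r ≥ ũ( (1/α)·Σ_{i=1}^n (yⁱ − μⁱ)·Zⁱ ), it holds that d(Λ̂) ≤ r·u(Λ*) + r·u(−Λ*). -/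

import Mathlib

open scoped ENNReal RealInnerProductSpace

/-- A regularizer on a real Hilbert space: `u Λ = 0` iff `Λ = 0`, and `u` is
positively homogeneous of degree one. -/
def IsRegularizer {H : Type*} [NormedAddCommGroup H] [InnerProductSpace ℝ H]
    (u : H → ℝ≥0∞) : Prop :=
  (∀ Λ : H, u Λ = 0 ↔ Λ = 0) ∧
    ∀ (Λ : H) (t : ℝ), Λ ≠ 0 → 0 ≤ t → u (t • Λ) = ENNReal.ofReal t * u Λ

/-- The dual of a regularizer. -/
noncomputable def dualReg {H : Type*} [NormedAddCommGroup H] [InnerProductSpace ℝ H]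
    (u : H → ℝ≥0∞) (Λ : H) : ℝ≥0∞ :=
  ⨆ (Λ' : H) (_ : u Λ' ≤ 1), ENNReal.ofReal ⟪Λ, Λ'⟫

/-- The generalized Hölder inequality for a regularizer and its dual. -/
theorem IsRegularizer.inner_le_mul_toReal {H : Type*} [NormedAddCommGroup H]
    [InnerProductSpace ℝ H] {u : H → ℝ≥0∞} (hu : IsRegularizer u) {G Λ : H} {r : ℝ}
    (hr : 0 ≤ r) (hG : dualReg u G ≤ ENNReal.ofReal r) (hΛ : u Λ ≠ ⊤) :
    ⟪G, Λ⟫ ≤ r * (u Λ).toReal := by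
  by_cases h0 : Λ = 0
  · subst h0
    simpa using mul_nonneg hr ENNReal.toReal_nonneg
  have hc : 0 < (u Λ).toReal := ENNReal.toReal_pos (mt (hu.1 Λ).1 h0) hΛ
  have hle : u ((u Λ).toReal⁻¹ • Λ) ≤ 1 := by
    rw [hu.2 Λ _ h0 (inv_nonneg.2 hc.le)]
    nth_rewrite 2 [← ENNReal.ofReal_toReal hΛ]
    rw [← ENNReal.ofReal_mul (inv_nonneg.2 hc.le), inv_mul_cancel₀ hc.ne', ENNReal.ofReal_one]
  have h := (le_iSup₂ (f := fun (Λ' : H) (_ : u Λ' ≤ 1) => ENNReal.ofReal ⟪G, Λ'⟫) _ hle).trans hG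
  rw [ENNReal.ofReal_le_ofReal_iff hr, real_inner_smul_right, inv_mul_le_iff₀ hc] at h
  linarith

/-- the oracle inequality for generalized linear tensor regression with
canonical link. Tensors in `ℝ^{b₁ × ⋯ × b_p}` are modeled as the Euclidean space
indexed by multi-indices `(k : Fin p) → Fin (bb k)`. -/
theorem glm_tensor_regression_oracle
    {n p : ℕ} {bb : Fin p → ℕ}
    (L : Set (EuclideanSpace ℝ ((k : Fin p) → Fin (bb k))))
    (hLne : L.Nonempty) (hLconv : Convex ℝ L)
    (Λstar : EuclideanSpace ℝ ((k : Fin p) → Fin (bb k))) (hΛstar : Λstar ∈ L)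
    (bfun : ℝ → ℝ) (hbfun : Differentiable ℝ bfun)
    (α : ℝ) (hα : 0 < α)
    (Z : Fin n → EuclideanSpace ℝ ((k : Fin p) → Fin (bb k)))
    (y : Fin n → ℝ)
    -- the conditional means `μⁱ = b'(⟨Λ*, Zⁱ⟩)`
    (m : Fin n → ℝ) (hm : ∀ i, m i = deriv bfun ⟪Λstar, Z i⟫)
    -- the Kullback-Leibler loss
    (d : EuclideanSpace ℝ ((k : Fin p) → Fin (bb k)) → ℝ)
    (hd : ∀ Λ, d Λ = 1 / α * ∑ i, (m i * ⟪Λstar - Λ, Z i⟫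
      - bfun ⟪Λstar, Z i⟫ + bfun ⟪Λ, Z i⟫))
    (u : EuclideanSpace ℝ ((k : Fin p) → Fin (bb k)) → ℝ≥0∞)
    (hu : IsRegularizer u) (hufin : u Λstar < ⊤) (hufin' : u (-Λstar) < ⊤)
    (r : ℝ) (hr : 0 < r)
    (Λhat : EuclideanSpace ℝ ((k : Fin p) → Fin (bb k))) (hΛhat : Λhat ∈ L)
    (hmin : ∀ Λ ∈ L,
      ((1 / α * ∑ i, (-(y i) * ⟪Λhat, Z i⟫ + bfun ⟪Λhat, Z i⟫) : ℝ) : EReal)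
          + ((ENNReal.ofReal r * u Λhat : ℝ≥0∞) : EReal)
        ≤ ((1 / α * ∑ i, (-(y i) * ⟪Λ, Z i⟫ + bfun ⟪Λ, Z i⟫) : ℝ) : EReal)
          + ((ENNReal.ofReal r * u Λ : ℝ≥0∞) : EReal))
    (hrG : dualReg u ((1 / α) • ∑ i, (y i - m i) • Z i) ≤ ENNReal.ofReal r) :
    d Λhat ≤ r * (u Λstar).toReal + r * (u (-Λstar)).toReal := by
  have hfin : ∀ {Λ}, u Λ < ⊤ → ((ENNReal.ofReal r * u Λ : ℝ≥0∞) : EReal)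
      = ((r * (u Λ).toReal : ℝ) : EReal) := fun {Λ} h => by
    rw [← EReal.coe_ennreal_toReal (ENNReal.mul_ne_top ENNReal.ofReal_ne_top h.ne)]
    simp [hr.le, ENNReal.toReal_mul]
  have hmin' := hmin Λstar hΛstar
  rw [hfin hufin, ← EReal.coe_add] at hmin'
  have hhat : u Λhat < ⊤ := by
    rw [lt_top_iff_ne_top]
    intro h
    rw [h, ENNReal.mul_top (ENNReal.ofReal_pos.2 hr).ne', EReal.coe_ennreal_top,
      EReal.coe_add_top, top_le_iff] at hmin'
    exact EReal.coe_ne_top _ hmin'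
  rw [hfin hhat, ← EReal.coe_add, EReal.coe_le_coe_iff] at hmin'
  have h1 := hu.inner_le_mul_toReal hr.le hrG hhat.ne
  have h2 := hu.inner_le_mul_toReal hr.le hrG hufin'.ne
  have key : d Λhat = 1 / α * ∑ i, (-(y i) * ⟪Λhat, Z i⟫ + bfun ⟪Λhat, Z i⟫)
      - 1 / α * ∑ i, (-(y i) * ⟪Λstar, Z i⟫ + bfun ⟪Λstar, Z i⟫)
      + ⟪(1 / α) • ∑ i, (y i - m i) • Z i, Λhat⟫
      + ⟪(1 / α) • ∑ i, (y i - m i) • Z i, -Λstar⟫ := by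
    simp only [hd, real_inner_smul_left, sum_inner, ← mul_add, ← mul_sub,
      ← Finset.sum_add_distrib, ← Finset.sum_sub_distrib]
    congr 1
    refine Finset.sum_congr rfl fun i _ => ?_
    rw [inner_sub_left, inner_neg_right, real_inner_comm Λhat (Z i),
      real_inner_comm Λstar (Z i)]
    ring
  linarith
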